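/- arXiv:1607.02087 — 2 statements merged into one kernel-verified Lean document; each statement's English description precedes it below -/
import Mathlib

section
/- For every real number ν ≥ 0, the number of triples (i₁,i₂,i₃) of positive integers with π²(i₁² + i₂² + i₃²) = ν is at most ν/(4π). In particular, the multiplicity of any Dirichlet eigenvalue ν of the unit cube is at most ν/(4π). -/
lemma quarter_integral : ∫ x in (0:ℝ)..1, √(1 - x ^ 2) = Real.pi / 4 := by
  have hc : Continuous fun x : ℝ => √(1 - x ^ 2) := by fun_prop
  have h := integral_sqrt_one_sub_sq
  have h1 := intervalIntegral.integral_add_adjacent_intervals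
    (hc.intervalIntegrable (μ := MeasureTheory.volume) (-1) 0) (hc.intervalIntegrable 0 1)
  have h2 := intervalIntegral.integral_comp_neg (a := 0) (b := 1) (fun x : ℝ => √(1 - x ^ 2))
  simp only [neg_sq, neg_zero] at h2
  linarith

lemma disk_integral (N : ℕ) (hN : 1 ≤ N) :
    ∫ x in (0:ℝ)..(N:ℝ), √((N:ℝ) - x ^ 2) = Real.pi / 4 * N := by
  have hc : Continuous fun x : ℝ => √(1 - x ^ 2) := by fun_prop
  have hN1 : (1:ℝ) ≤ N := by exact_mod_cast hN
  have hr1 : 1 ≤ √(N:ℝ) := Real.one_le_sqrt.mpr hN1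
  have hr : √(N:ℝ) ≠ 0 := by positivity
  have hsq : √(N:ℝ) * √(N:ℝ) = N := Real.mul_self_sqrt (by positivity)
  have hf : ∀ x : ℝ, √((N:ℝ) - x ^ 2) = √(N:ℝ) * √(1 - (x / √(N:ℝ)) ^ 2) := by
    intro x
    rw [← Real.sqrt_mul (by positivity), div_pow, Real.sq_sqrt (by positivity)]
    congr 1
    field_simp
  simp_rw [hf]
  rw [intervalIntegral.integral_const_mul,
    intervalIntegral.integral_comp_div (fun x : ℝ => √(1 - x ^ 2)) hr]
  have e : (N:ℝ) / √(N:ℝ) = √(N:ℝ) := by rw [div_eq_iff hr, hsq]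
  have h1 := intervalIntegral.integral_add_adjacent_intervals
    (hc.intervalIntegrable (μ := MeasureTheory.volume) 0 1) (hc.intervalIntegrable 1 (√(N:ℝ)))
  have h2 : ∫ x in (1:ℝ)..√(N:ℝ), √(1 - x ^ 2) = 0 := by
    rw [intervalIntegral.integral_congr (g := fun _ => (0:ℝ))]
    · simp
    · intro x hx
      rw [Set.uIcc_of_le hr1] at hx
      exact Real.sqrt_eq_zero_of_nonpos (by nlinarith [hx.1])
  rw [zero_div, e, ← h1, h2, quarter_integral, smul_eq_mul, ← mul_assoc, hsq]
  ring

lemma sum_bound (N : ℕ) (hN : 1 ≤ N) :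
    ((∑ i ∈ Finset.range N, Nat.sqrt (N - (i + 1) ^ 2) : ℕ) : ℝ) ≤ Real.pi / 4 * N := by
  have ha : AntitoneOn (fun x : ℝ => √((N:ℝ) - x ^ 2)) (Set.Icc (0:ℝ) (0 + (N:ℝ))) := by
    intro x hx y hy hxy
    apply Real.sqrt_le_sqrt
    nlinarith [hx.1]
  have h := ha.sum_le_integral
  rw [zero_add, disk_integral N hN] at h
  refine le_trans ?_ h
  push_cast
  apply Finset.sum_le_sum
  intro i _
  refine le_trans Real.nat_sqrt_le_real_sqrt ?_
  rcases le_total ((i + 1) ^ 2) N with h | h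
  · apply Real.sqrt_le_sqrt
    rw [Nat.cast_sub h]
    push_cast
    simp
  · rw [Nat.sub_eq_zero_of_le h]
    simp

theorem cube_multiplicity_upper_bound (ν : ℝ) (hν : 0 ≤ ν) :
    (Nat.card {p : ℤ × ℤ × ℤ // 1 ≤ p.1 ∧ 1 ≤ p.2.1 ∧ 1 ≤ p.2.2 ∧
        Real.pi ^ 2 * ((p.1 : ℝ) ^ 2 + (p.2.1 : ℝ) ^ 2 + (p.2.2 : ℝ) ^ 2) = ν} : ℝ)
      ≤ ν / (4 * Real.pi) := by
  have hpi := Real.pi_pos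
  rcases isEmpty_or_nonempty {p : ℤ × ℤ × ℤ // 1 ≤ p.1 ∧ 1 ≤ p.2.1 ∧ 1 ≤ p.2.2 ∧
        Real.pi ^ 2 * ((p.1 : ℝ) ^ 2 + (p.2.1 : ℝ) ^ 2 + (p.2.2 : ℝ) ^ 2) = ν} with he | ⟨⟨q, hq⟩⟩
  · rw [Nat.card_of_isEmpty, Nat.cast_zero]
    positivity
  obtain ⟨N, hNq⟩ : ∃ N : ℕ, (N : ℤ) = q.1 ^ 2 + q.2.1 ^ 2 + q.2.2 ^ 2 :=
    ⟨_, Int.toNat_of_nonneg (by positivity)⟩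
  have hνN : ν = Real.pi ^ 2 * N := by
    rw [← hq.2.2.2]
    congr 1
    exact_mod_cast hNq.symm
  have hN : 1 ≤ N := by
    zify
    nlinarith [hq.1]
  have key : ∀ p : ℤ × ℤ × ℤ,
      Real.pi ^ 2 * ((p.1 : ℝ) ^ 2 + (p.2.1 : ℝ) ^ 2 + (p.2.2 : ℝ) ^ 2) = ν →
      p.1 ^ 2 + p.2.1 ^ 2 + p.2.2 ^ 2 = (N : ℤ) := by
    intro p hp
    rw [hνN] at hp
    exact_mod_cast mul_left_cancel₀ (by positivity) hp
  let T : Finset (Σ _ : ℕ, ℕ) :=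
    (Finset.range N).sigma fun i => Finset.range (Nat.sqrt (N - (i + 1) ^ 2))
  have hcard : Nat.card {p : ℤ × ℤ × ℤ // 1 ≤ p.1 ∧ 1 ≤ p.2.1 ∧ 1 ≤ p.2.2 ∧
        Real.pi ^ 2 * ((p.1 : ℝ) ^ 2 + (p.2.1 : ℝ) ^ 2 + (p.2.2 : ℝ) ^ 2) = ν} ≤ T.card := by
    rw [← Nat.card_eq_finsetCard T]
    have hmem : ∀ p : ℤ × ℤ × ℤ, (1 ≤ p.1 ∧ 1 ≤ p.2.1 ∧ 1 ≤ p.2.2 ∧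
        Real.pi ^ 2 * ((p.1 : ℝ) ^ 2 + (p.2.1 : ℝ) ^ 2 + (p.2.2 : ℝ) ^ 2) = ν) →
        (⟨(p.1 - 1).toNat, (p.2.1 - 1).toNat⟩ : Σ _ : ℕ, ℕ) ∈ T := by
      rintro ⟨a, b, c⟩ ⟨h1, h2, h3, h4⟩
      have hk := key _ h4
      simp only at h1 h2 h3 hk ⊢
      obtain ⟨a', rfl⟩ : ∃ a' : ℕ, a = a' + 1 := ⟨(a - 1).toNat, by omega⟩
      obtain ⟨b', rfl⟩ : ∃ b' : ℕ, b = b' + 1 := ⟨(b - 1).toNat, by omega⟩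
      simp only [add_sub_cancel_right, Int.toNat_natCast, T, Finset.mem_sigma, Finset.mem_range]
      constructor
      · zify
        nlinarith
      · rw [← Nat.succ_le_iff, Nat.le_sqrt']
        apply Nat.le_sub_of_add_le
        zify
        push_cast
        nlinarith
    refine Nat.card_le_card_of_injective (fun p => (⟨_, hmem p.1 p.2⟩ : T)) ?_
    rintro ⟨⟨a, b, c⟩, h1, h2, h3, h4⟩ ⟨⟨a', b', c'⟩, h1', h2', h3', h4'⟩ h
    have hk := key _ h4
    have hk' := key _ h4'
    simp only [Subtype.mk.injEq, Sigma.mk.injEq, heq_eq_eq] at h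
    simp only at h1 h2 h3 h1' h2' h3' hk hk'
    obtain rfl : a = a' := by omega
    obtain rfl : b = b' := by omega
    obtain rfl : c = c' := by nlinarith
    rfl
  have hT : T.card = ∑ i ∈ Finset.range N, Nat.sqrt (N - (i + 1) ^ 2) := by
    simp [T]
  calc _ ≤ (T.card : ℝ) := by exact_mod_cast hcard
    _ ≤ Real.pi / 4 * N := by rw [hT]; exact sum_bound N hN
    _ = _ := by rw [hνN]; field_simp
end

section
/- Suppose β ∈ [0,2) and C > 0 form a sphere-remainder pair and θ ∈ [0,2) and D > 0 form a circle-remainder pair. Then for every ε > 0 there exists a constant C' > 0 such that for all integers k ≥ 1, (ν_k^{3/2} − 6π²k)/(6π²ν_k) ≤ 3/(8π) + C'(k^{-(2-β)/3} + k^{-(2-θ)/3} + k^{-1/3 + ε}). -/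
/-- The Dirichlet eigenvalue counting function of the cuboid `(0,a₁)×(0,a₂)×(0,a₃)`:
the number of triples `(i₁,i₂,i₃) ∈ ℤ³` with `i₁,i₂,i₃ ≥ 1` and
`π²(i₁²/a₁² + i₂²/a₂² + i₃²/a₃²) ≤ lam`. -/
noncomputable def cuboidCount (a₁ a₂ a₃ lam : ℝ) : ℕ :=
  Nat.card {p : ℤ × ℤ × ℤ //
    1 ≤ p.1 ∧ 1 ≤ p.2.1 ∧ 1 ≤ p.2.2 ∧
    Real.pi ^ 2 * ((p.1 : ℝ) ^ 2 / a₁ ^ 2 + (p.2.1 : ℝ) ^ 2 / a₂ ^ 2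
      + (p.2.2 : ℝ) ^ 2 / a₃ ^ 2) ≤ lam}

/-- `cuboidEig a₁ a₂ a₃ k` is the `k`-th smallest Dirichlet eigenvalue (counted with
multiplicity) of the cuboid `(0,a₁)×(0,a₂)×(0,a₃)`, expressed as the least `lam` whose
eigenvalue count is at least `k`. -/
noncomputable def cuboidEig (a₁ a₂ a₃ : ℝ) (k : ℕ) : ℝ :=
  sInf {lam : ℝ | k ≤ cuboidCount a₁ a₂ a₃ lam}

/-- `(a₁,a₂,a₃)` is a minimiser for `λ_k` among cuboids of unit measure. -/
noncomputable def IsMinimiser (k : ℕ) (a₁ a₂ a₃ : ℝ) : Prop :=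
  0 < a₁ ∧ a₁ ≤ a₂ ∧ a₂ ≤ a₃ ∧ a₁ * a₂ * a₃ = 1 ∧
    ∀ b₁ b₂ b₃ : ℝ, 0 < b₁ → b₁ ≤ b₂ → b₂ ≤ b₃ → b₁ * b₂ * b₃ = 1 →
      cuboidEig a₁ a₂ a₃ k ≤ cuboidEig b₁ b₂ b₃ k

/-- `(β, C)` is a sphere-remainder pair: `β ∈ [0,2)`, `C > 0`, and the number of integer
lattice points in the closed ball of radius `R` in `ℝ³` differs from `(4π/3)R³` by at
most `C(R^β + 1)` for all `R ≥ 0`. -/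
noncomputable def SphereRemainderPair (β C : ℝ) : Prop :=
  0 ≤ β ∧ β < 2 ∧ 0 < C ∧ ∀ R : ℝ, 0 ≤ R →
    |(Nat.card {p : ℤ × ℤ × ℤ //
        (p.1 : ℝ) ^ 2 + (p.2.1 : ℝ) ^ 2 + (p.2.2 : ℝ) ^ 2 ≤ R ^ 2} : ℝ)
      - (4 * Real.pi / 3) * R ^ 3| ≤ C * (R ^ β + 1)

/-- `(θ, D)` is a circle-remainder pair: `θ ∈ [0,2)`, `D > 0`, and the number of integer
lattice points in the closed disc of radius `R` in `ℝ²` differs from `πR²` by at most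
`D(R^θ + 1)` for all `R ≥ 0`. -/
noncomputable def CircleRemainderPair (θ D : ℝ) : Prop :=
  0 ≤ θ ∧ θ < 2 ∧ 0 < D ∧ ∀ R : ℝ, 0 ≤ R →
    |(Nat.card {p : ℤ × ℤ //
        (p.1 : ℝ) ^ 2 + (p.2 : ℝ) ^ 2 ≤ R ^ 2} : ℝ)
      - Real.pi * R ^ 2| ≤ D * (R ^ θ + 1)

/-- Positive octant lattice points in the ball of radius `R`. -/
def octSet (R : ℝ) : Set (ℤ × ℤ × ℤ) :=
  {p | 1 ≤ p.1 ∧ 1 ≤ p.2.1 ∧ 1 ≤ p.2.2 ∧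
    (p.1 : ℝ) ^ 2 + (p.2.1 : ℝ) ^ 2 + (p.2.2 : ℝ) ^ 2 ≤ R ^ 2}

/-- Lattice points in the disc. -/
def discSet (R : ℝ) : Set (ℤ × ℤ) := {p | (p.1 : ℝ) ^ 2 + (p.2 : ℝ) ^ 2 ≤ R ^ 2}

/-- Lattice points in the ball. -/
def ballSet (R : ℝ) : Set (ℤ × ℤ × ℤ) :=
  {p | (p.1 : ℝ) ^ 2 + (p.2.1 : ℝ) ^ 2 + (p.2.2 : ℝ) ^ 2 ≤ R ^ 2}

lemma cuboidCount_eq (R : ℝ) : cuboidCount 1 1 1 (Real.pi ^ 2 * R ^ 2) = (octSet R).ncard := by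
  have h : octSet R = {p : ℤ × ℤ × ℤ | 1 ≤ p.1 ∧ 1 ≤ p.2.1 ∧ 1 ≤ p.2.2 ∧
    Real.pi ^ 2 * ((p.1 : ℝ) ^ 2 / 1 ^ 2 + (p.2.1 : ℝ) ^ 2 / 1 ^ 2
      + (p.2.2 : ℝ) ^ 2 / 1 ^ 2) ≤ Real.pi ^ 2 * R ^ 2} := by
    ext p
    have hp : 0 < Real.pi ^ 2 := by positivity
    simp only [octSet, Set.mem_ofPred_eq, one_pow, div_one, mul_le_mul_iff_right₀ hp]
  rw [h]
  rfl

lemma int_mem_of_sq_le {R : ℝ} (hR : 0 ≤ R) {x : ℤ} (h : (x : ℝ) ^ 2 ≤ R ^ 2) :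
    x ∈ Set.Icc (-⌊R⌋) ⌊R⌋ := by
  have := abs_le_of_sq_le_sq' h hR
  constructor
  · have : -x ≤ ⌊R⌋ := Int.le_floor.2 (by push_cast; linarith [this.1])
    linarith
  · exact Int.le_floor.2 this.2

lemma octSet_sub {R : ℝ} (hR : 0 ≤ R) :
    octSet R ⊆ ((Finset.Icc 1 ⌊R⌋ ×ˢ Finset.Icc 1 ⌊R⌋ ×ˢ Finset.Icc 1 ⌊R⌋ :
      Finset (ℤ × ℤ × ℤ)) : Set (ℤ × ℤ × ℤ)) := by
  rintro ⟨x, y, z⟩ ⟨hx, hy, hz, h⟩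
  simp only at hx hy hz h
  have h1 := int_mem_of_sq_le hR (x := x) (by nlinarith)
  have h2 := int_mem_of_sq_le hR (x := y) (by nlinarith)
  have h3 := int_mem_of_sq_le hR (x := z) (by nlinarith)
  simp only [Finset.coe_product, Finset.coe_Icc, Set.mem_prod]
  exact ⟨⟨hx, h1.2⟩, ⟨hy, h2.2⟩, ⟨hz, h3.2⟩⟩

lemma octSet_finite {R : ℝ} (hR : 0 ≤ R) : (octSet R).Finite :=
  (Finset.finite_toSet _).subset (octSet_sub hR)

lemma discSet_finite {R : ℝ} (hR : 0 ≤ R) : (discSet R).Finite := by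
  refine ((Set.finite_Icc (-⌊R⌋) ⌊R⌋).prod (Set.finite_Icc (-⌊R⌋) ⌊R⌋)).subset ?_
  rintro ⟨x, y⟩ h
  simp only [discSet, Set.mem_ofPred_eq] at h
  exact ⟨int_mem_of_sq_le hR (by nlinarith), int_mem_of_sq_le hR (by nlinarith)⟩

lemma octSet_card_le {R : ℝ} (hR : 0 ≤ R) : ((octSet R).ncard : ℝ) ≤ R ^ 3 := by
  have h := Set.ncard_le_ncard (octSet_sub hR) (Finset.finite_toSet _)
  rw [Set.ncard_coe_finset] at h
  simp only [Finset.card_product, Int.card_Icc, add_sub_cancel_right] at h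
  have hf : ((⌊R⌋.toNat : ℕ) : ℝ) ≤ R := by
    have h0 : 0 ≤ ⌊R⌋ := Int.floor_nonneg.2 hR
    have : ((⌊R⌋.toNat : ℤ) : ℝ) = (⌊R⌋ : ℝ) := by rw [Int.toNat_of_nonneg h0]
    calc ((⌊R⌋.toNat : ℕ) : ℝ) = (⌊R⌋ : ℝ) := by exact_mod_cast this
      _ ≤ R := Int.floor_le R
  calc ((octSet R).ncard : ℝ) ≤ (⌊R⌋.toNat : ℝ) * (⌊R⌋.toNat * ⌊R⌋.toNat) := by exact_mod_cast h
    _ = (⌊R⌋.toNat : ℝ) ^ 3 := by ring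
    _ ≤ R ^ 3 := by gcongr

/-- Sign attached to a Boolean. -/
def sgnB (b : Bool) : ℤ := if b then 1 else -1

/-- Reflect a triple by three signs. -/
def reflB (q : (Bool × Bool × Bool) × (ℤ × ℤ × ℤ)) : ℤ × ℤ × ℤ :=
  (sgnB q.1.1 * q.2.1, sgnB q.1.2.1 * q.2.2.1, sgnB q.1.2.2 * q.2.2.2)

lemma exists_sgn {x : ℤ} (hx : x ≠ 0) : ∃ b, ∃ y : ℤ, 1 ≤ y ∧ sgnB b * y = x ∧
    (y : ℝ) ^ 2 = (x : ℝ) ^ 2 := by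
  rcases lt_or_gt_of_ne hx with h | h
  · exact ⟨false, -x, by omega, by simp [sgnB], by push_cast; ring⟩
  · exact ⟨true, x, by omega, by simp [sgnB], rfl⟩

lemma ball_le {R : ℝ} (hR : 0 ≤ R) :
    (ballSet R).ncard ≤ 8 * (octSet R).ncard + 3 * (discSet R).ncard := by
  have hsub : ballSet R ⊆ (Set.image reflB ((Set.univ : Set (Bool × Bool × Bool)) ×ˢ octSet R)) ∪
      ((Set.image (fun p : ℤ × ℤ => ((0 : ℤ), p.1, p.2)) (discSet R)) ∪
      ((Set.image (fun p : ℤ × ℤ => (p.1, (0 : ℤ), p.2)) (discSet R)) ∪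
      (Set.image (fun p : ℤ × ℤ => (p.1, p.2, (0 : ℤ))) (discSet R)))) := by
    rintro ⟨x, y, z⟩ h
    simp only [ballSet, Set.mem_ofPred_eq] at h
    by_cases hx : x = 0
    · subst hx
      exact Or.inr (Or.inl ⟨(y, z), by simpa [discSet] using h, rfl⟩)
    by_cases hy : y = 0
    · subst hy
      exact Or.inr (Or.inr (Or.inl ⟨(x, z), by simpa [discSet] using h, rfl⟩))
    by_cases hz : z = 0
    · subst hz
      exact Or.inr (Or.inr (Or.inr ⟨(x, y), by simpa [discSet] using h, rfl⟩))
    obtain ⟨a, x', h1, h2, h3⟩ := exists_sgn hx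
    obtain ⟨b, y', k1, k2, k3⟩ := exists_sgn hy
    obtain ⟨c, z', l1, l2, l3⟩ := exists_sgn hz
    refine Or.inl ⟨((a, b, c), (x', y', z')), ⟨Set.mem_univ _, h1, k1, l1, ?_⟩, ?_⟩
    · simp only [h3, k3, l3]; exact h
    · simp [reflB, h2, k2, l2]
  have hd := discSet_finite hR
  have ho := octSet_finite hR
  have hp : ((Set.univ : Set (Bool × Bool × Bool)) ×ˢ octSet R).Finite := Set.finite_univ.prod ho
  have hc := Set.ncard_le_ncard hsub
    ((hp.image _).union ((hd.image _).union ((hd.image _).union (hd.image _))))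
  have e1 := Set.ncard_image_le (f := reflB) hp
  rw [Set.ncard_prod, Set.ncard_univ] at e1
  have e8 : Nat.card (Bool × Bool × Bool) = 8 := by simp
  rw [e8] at e1
  have d1 := Set.ncard_image_le (f := fun p : ℤ × ℤ => ((0 : ℤ), p.1, p.2)) hd
  have d2 := Set.ncard_image_le (f := fun p : ℤ × ℤ => (p.1, (0 : ℤ), p.2)) hd
  have d3 := Set.ncard_image_le (f := fun p : ℤ × ℤ => (p.1, p.2, (0 : ℤ))) hd
  have u1 := hc.trans (Set.ncard_union_le _ _)
  have u2 := u1.trans (Nat.add_le_add_left (Set.ncard_union_le _ _) _)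
  have u3 := u2.trans (Nat.add_le_add_left (Nat.add_le_add_left (Set.ncard_union_le _ _) _) _)
  omega

lemma oct_lower {β C θ D : ℝ} (hsp : SphereRemainderPair β C) (hcp : CircleRemainderPair θ D)
    {R : ℝ} (hR : 0 ≤ R) :
    (4 * Real.pi / 3) * R ^ 3 - C * (R ^ β + 1) - 3 * (Real.pi * R ^ 2 + D * (R ^ θ + 1)) ≤
      8 * ((octSet R).ncard : ℝ) := by
  have h1 : |((ballSet R).ncard : ℝ) - (4 * Real.pi / 3) * R ^ 3| ≤ C * (R ^ β + 1) :=
    hsp.2.2.2 R hR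
  have h2 : |((discSet R).ncard : ℝ) - Real.pi * R ^ 2| ≤ D * (R ^ θ + 1) := hcp.2.2.2 R hR
  have h3 : ((ballSet R).ncard : ℝ) ≤ 8 * (octSet R).ncard + 3 * (discSet R).ncard := by
    exact_mod_cast ball_le hR
  have := (abs_le.1 h1).1
  have := (abs_le.1 h2).2
  linarith

lemma count_neg {lam : ℝ} (h : lam < 0) : cuboidCount 1 1 1 lam = 0 := by
  unfold cuboidCount
  have : IsEmpty {p : ℤ × ℤ × ℤ //
    1 ≤ p.1 ∧ 1 ≤ p.2.1 ∧ 1 ≤ p.2.2 ∧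
    Real.pi ^ 2 * ((p.1 : ℝ) ^ 2 / 1 ^ 2 + (p.2.1 : ℝ) ^ 2 / 1 ^ 2
      + (p.2.2 : ℝ) ^ 2 / 1 ^ 2) ≤ lam} := by
    constructor
    rintro ⟨p, -, -, -, hp⟩
    have : 0 ≤ Real.pi ^ 2 * ((p.1 : ℝ) ^ 2 / 1 ^ 2 + (p.2.1 : ℝ) ^ 2 / 1 ^ 2
      + (p.2.2 : ℝ) ^ 2 / 1 ^ 2) := by positivity
    linarith
  exact Nat.card_of_isEmpty

lemma oct_mono {R S : ℝ} (hR : 0 ≤ R) (h : R ≤ S) : (octSet R).ncard ≤ (octSet S).ncard := by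
  refine Set.ncard_le_ncard ?_ (octSet_finite (hR.trans h))
  rintro p ⟨h1, h2, h3, h4⟩
  exact ⟨h1, h2, h3, h4.trans (by gcongr)⟩

lemma oct_large (k : ℕ) : k ≤ (octSet ((k : ℝ) + 2)).ncard := by
  have hs : Set.image (fun i : ℤ => (i, (1 : ℤ), (1 : ℤ))) ((Finset.Icc (1 : ℤ) k : Finset ℤ) : Set ℤ) ⊆
      octSet ((k : ℝ) + 2) := by
    rintro _ ⟨i, hi, rfl⟩
    simp only [Finset.coe_Icc, Set.mem_Icc] at hi
    refine ⟨hi.1, le_rfl, le_rfl, ?_⟩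
    have a : (1 : ℝ) ≤ i := by exact_mod_cast hi.1
    have b : (i : ℝ) ≤ k := by exact_mod_cast hi.2
    push_cast
    nlinarith
  have h := Set.ncard_le_ncard hs (octSet_finite (by positivity))
  rw [Set.ncard_image_of_injective _ (fun a b h => by simpa using h), Set.ncard_coe_finset] at h
  simpa using h

lemma eig_facts {k : ℕ} (hk : 1 ≤ k) : ∃ R : ℝ, 0 ≤ R ∧
    cuboidEig 1 1 1 k = Real.pi ^ 2 * R ^ 2 ∧
    (∀ S, R < S → k ≤ (octSet S).ncard) ∧ (∀ S, 0 ≤ S → S < R → (octSet S).ncard < k) := by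
  set A := {lam : ℝ | k ≤ cuboidCount 1 1 1 lam} with hA
  have hpi := Real.pi_pos
  have hlow : ∀ lam ∈ A, 0 ≤ lam := by
    intro lam hl
    by_contra hn
    have := count_neg (not_le.1 hn)
    simp only [hA, Set.mem_ofPred_eq] at hl
    omega
  have hbdd : BddBelow A := ⟨0, hlow⟩
  have hne : A.Nonempty := ⟨Real.pi ^ 2 * ((k : ℝ) + 2) ^ 2, by
    simp only [hA, Set.mem_ofPred_eq, cuboidCount_eq]; exact oct_large k⟩
  have h0 : 0 ≤ sInf A := le_csInf hne hlow
  have heq : sInf A = Real.pi ^ 2 * (√(sInf A) / Real.pi) ^ 2 := by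
    rw [div_pow, Real.sq_sqrt h0]; field_simp
  have hR0 : 0 ≤ √(sInf A) / Real.pi := by positivity
  refine ⟨√(sInf A) / Real.pi, hR0, heq, ?_, ?_⟩
  · intro S hS
    have : sInf A < Real.pi ^ 2 * S ^ 2 := by rw [heq]; gcongr
    obtain ⟨lam, hl, hlS⟩ := exists_lt_of_csInf_lt hne this
    have hl0 := hlow lam hl
    have e : lam = Real.pi ^ 2 * (√lam / Real.pi) ^ 2 := by
      rw [div_pow, Real.sq_sqrt hl0]; field_simp
    have hl' : k ≤ (octSet (√lam / Real.pi)).ncard := by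
      rw [← cuboidCount_eq, ← e]; exact hl
    refine hl'.trans (oct_mono (by positivity) ?_)
    rw [e] at hlS
    have := lt_of_mul_lt_mul_left hlS (by positivity)
    exact (lt_of_pow_lt_pow_left₀ 2 (hR0.trans hS.le) this).le
  · intro S hS0 hS
    by_contra hn
    have hm : Real.pi ^ 2 * S ^ 2 ∈ A := by
      simp only [hA, Set.mem_ofPred_eq, cuboidCount_eq]; exact not_lt.1 hn
    have h1 := csInf_le hbdd hm
    have : Real.pi ^ 2 * S ^ 2 < sInf A := by rw [heq]; gcongr
    linarith

lemma eig_bounds {β C θ D : ℝ} (hsp : SphereRemainderPair β C) (hcp : CircleRemainderPair θ D)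
    {k : ℕ} (hk : 1 ≤ k) : ∃ R : ℝ, 0 ≤ R ∧
    cuboidEig 1 1 1 k = Real.pi ^ 2 * R ^ 2 ∧ (k : ℝ) ≤ R ^ 3 ∧
    (4 * Real.pi / 3) * R ^ 3 - C * (R ^ β + 1) - 3 * (Real.pi * R ^ 2 + D * (R ^ θ + 1)) ≤
      8 * (k : ℝ) := by
  obtain ⟨R, hR0, he, h1, h2⟩ := eig_facts hk
  have hkR : (k : ℝ) ≤ R ^ 3 := by
    have ht : Filter.Tendsto (fun S : ℝ => S ^ 3) (nhdsWithin R (Set.Ioi R)) (nhds (R ^ 3)) :=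
      ((continuous_pow 3).tendsto R).mono_left nhdsWithin_le_nhds
    refine ge_of_tendsto ht ?_
    filter_upwards [self_mem_nhdsWithin] with S hS
    exact (Nat.cast_le.2 (h1 S hS)).trans (octSet_card_le (hR0.trans (le_of_lt hS)))
  refine ⟨R, hR0, he, hkR, ?_⟩
  have hRpos : 0 < R := by
    rcases hR0.lt_or_eq with h | h
    · exact h
    · rw [← h] at hkR
      have : (1 : ℝ) ≤ k := by exact_mod_cast hk
      norm_num at hkR
      omega
  have hc : ContinuousAt (fun S : ℝ => (4 * Real.pi / 3) * S ^ 3 - C * (S ^ β + 1)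
      - 3 * (Real.pi * S ^ 2 + D * (S ^ θ + 1))) R := by
    have a1 : ContinuousAt (fun S : ℝ => S ^ β) R := Real.continuousAt_rpow_const _ _ (Or.inl hRpos.ne')
    have a2 : ContinuousAt (fun S : ℝ => S ^ θ) R := Real.continuousAt_rpow_const _ _ (Or.inl hRpos.ne')
    fun_prop
  refine le_of_tendsto (hc.tendsto.mono_left (nhdsWithin_le_nhds (s := Set.Iio R))) ?_
  filter_upwards [Ioo_mem_nhdsLT hRpos] with S hS
  refine (oct_lower hsp hcp hS.1.le).trans ?_
  have : ((octSet S).ncard : ℝ) ≤ k := by exact_mod_cast (h2 S hS.1.le hS.2).le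
  linarith

lemma rpow_cmp {R k a : ℝ} (hk : 1 ≤ k) (hR : 0 < R) (hkR : k ≤ R ^ 3) (ha : a < 2) :
    R ^ a / R ^ 2 ≤ k ^ (-(2 - a) / 3) := by
  have e : R ^ a / R ^ 2 = (R ^ 3) ^ (-(2 - a) / 3) := by
    rw [← Real.rpow_natCast R 2, ← Real.rpow_sub hR, ← Real.rpow_natCast R 3, ← Real.rpow_mul hR.le]
    congr 1
    push_cast
    ring
  rw [e]
  exact Real.rpow_le_rpow_of_nonpos (by linarith) hkR (by linarith)

/-- If `(β,C)` is a sphere-remainder pair and `(θ,D)` is a circle-remainder pair, then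
for every `ε > 0` there is `C' > 0` such that for all `k ≥ 1`, with `ν_k` the `k`-th
Dirichlet eigenvalue of the unit cube,
`(ν_k^{3/2} − 6π²k)/(6π²ν_k) ≤ 3/(8π) + C'(k^{-(2-β)/3} + k^{-(2-θ)/3} + k^{-1/3+ε})`. -/
theorem cube_deficit_upper_bound (β C θ D : ℝ)
    (hsp : SphereRemainderPair β C) (hcp : CircleRemainderPair θ D)
    (ε : ℝ) (hε : 0 < ε) :
    ∃ C' : ℝ, 0 < C' ∧ ∀ k : ℕ, 1 ≤ k →
      ((cuboidEig 1 1 1 k) ^ ((3 : ℝ) / 2) - 6 * Real.pi ^ 2 * k)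
          / (6 * Real.pi ^ 2 * cuboidEig 1 1 1 k)
        ≤ 3 / (8 * Real.pi)
          + C' * ((k : ℝ) ^ (-(2 - β) / 3) + (k : ℝ) ^ (-(2 - θ) / 3)
              + (k : ℝ) ^ (-(1 : ℝ) / 3 + ε)) := by
  have hpi := Real.pi_pos
  have hC := hsp.2.2.1
  have hD := hcp.2.2.1
  refine ⟨C + 3 * D, by positivity, ?_⟩
  intro k hk
  obtain ⟨R, hR0, he, hkR, hlow⟩ := eig_bounds hsp hcp hk
  have hk1 : (1 : ℝ) ≤ k := by exact_mod_cast hk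
  have hR : 0 < R := by
    rcases hR0.lt_or_eq with h | h
    · exact h
    · rw [← h] at hkR
      norm_num at hkR
      omega
  have hb := rpow_cmp hk1 hR hkR hsp.2.1
  have ht := rpow_cmp hk1 hR hkR hcp.2.1
  have h0 := rpow_cmp (a := 0) hk1 hR hkR (by norm_num)
  have h0' : (k : ℝ) ^ (-(2 - (0 : ℝ)) / 3) ≤ (k : ℝ) ^ (-(1 : ℝ) / 3 + ε) :=
    Real.rpow_le_rpow_of_exponent_le hk1 (by linarith)
  have h1 := h0.trans h0'
  rw [Real.rpow_zero] at h1
  have hpow : (Real.pi ^ 2 * R ^ 2) ^ ((3 : ℝ) / 2) = Real.pi ^ 3 * R ^ 3 := by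
    rw [← mul_pow, ← mul_pow, ← Real.rpow_natCast (Real.pi * R) 2,
      ← Real.rpow_mul (by positivity), ← Real.rpow_natCast (Real.pi * R) 3]
    norm_num
  rw [he, hpow]
  set X := (k : ℝ) ^ (-(2 - β) / 3)
  set Y := (k : ℝ) ^ (-(2 - θ) / 3)
  set Z := (k : ℝ) ^ (-(1 : ℝ) / 3 + ε)
  have hX : 0 ≤ X := by positivity
  have hY : 0 ≤ Y := by positivity
  have hZ : 0 ≤ Z := by positivity
  have hR2 : 0 < R ^ 2 := by positivity
  rw [div_le_iff₀ hR2] at hb ht h1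
  rw [div_le_iff₀ (by positivity)]
  have e : (3 / (8 * Real.pi) + (C + 3 * D) * (X + Y + Z)) * (6 * Real.pi ^ 2 * (Real.pi ^ 2 * R ^ 2))
      = 9 / 4 * Real.pi ^ 3 * R ^ 2
        + 6 * Real.pi ^ 4 * ((C + 3 * D) * (X + Y + Z) * R ^ 2) := by
    field_simp
    ring
  rw [e]
  have hmain : C * (R ^ β + 1) + 3 * (D * (R ^ θ + 1)) ≤ (C + 3 * D) * (X + Y + Z) * R ^ 2 := by
    have i1 : C * (R ^ β + 1) ≤ C * (X * R ^ 2 + Z * R ^ 2) := by gcongr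
    have i2 : D * (R ^ θ + 1) ≤ D * (Y * R ^ 2 + Z * R ^ 2) := by gcongr
    have i3 : 0 ≤ C * (Y * R ^ 2) := by positivity
    have i4 : 0 ≤ D * (X * R ^ 2) := by positivity
    linarith
  set M := C * (R ^ β + 1) + 3 * (D * (R ^ θ + 1)) with hM
  have hM0 : 0 ≤ M := by positivity
  set W := (C + 3 * D) * (X + Y + Z) * R ^ 2
  have s1 : 3 / 4 * Real.pi ^ 2 * (4 * Real.pi / 3 * R ^ 3 - 3 * Real.pi * R ^ 2 - M) ≤
      3 / 4 * Real.pi ^ 2 * (8 * k) := by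
    gcongr
    linarith
  have s2 : 3 / 4 * Real.pi ^ 2 * M ≤ 6 * Real.pi ^ 4 * W := by
    have q : 3 / 4 * Real.pi ^ 2 ≤ 6 * Real.pi ^ 4 := by
      have : 1 ≤ Real.pi ^ 2 := one_le_pow₀ (by linarith [Real.pi_gt_three])
      nlinarith
    gcongr
  nlinarith
end
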